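/- arXiv:1102.0770 — 3 statements merged into one kernel-verified Lean document; each statement's English description precedes it below -/
import Mathlib

section
/- Let S be an instance of CLH(3,2) on particles 1,…,n such that no qubit is separable for S and the interaction graph G_S is connected. Then the particles are operator-path-connected: for any pair of particles q and v there exists an open operator path H_1, …, H_L in S with q ∈ A_{H_1} and v ∈ A_{H_L}. (Claim 4.11: graph connectivity implies operator-path connectivity in an instance with no separable qubits.) -/
open Matrix

/-- An operator on a system of `n` qubits acts trivially on qubit `i` if it is the identity
on `H_i` tensored with an operator on the remaining factors. -/
def ActsTriviallyAt {n : ℕ}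
    (M : Matrix (Fin n → Fin 2) (Fin n → Fin 2) ℂ) (i : Fin n) : Prop :=
  ∃ N : Matrix ({j : Fin n // j ≠ i} → Fin 2) ({j : Fin n // j ≠ i} → Fin 2) ℂ,
    ∀ x y, M x y = (if x i = y i then (1 : ℂ) else 0) * N (fun j => x j.1) (fun j => y j.1)

/-- The support of an operator: the set of qubits on which it acts nontrivially. -/
def supp {n : ℕ} (M : Matrix (Fin n → Fin 2) (Fin n → Fin 2) ℂ) : Set (Fin n) :=
  {i | ¬ ActsTriviallyAt M i}

/-- The orthogonal projection onto `ℂv` at site `i`, tensored with the identity on all other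
qubits. -/
def projAt {n : ℕ} (i : Fin n) (v : Fin 2 → ℂ) :
    Matrix (Fin n → Fin 2) (Fin n → Fin 2) ℂ :=
  Matrix.of fun x y =>
    if Function.update x i (y i) = y then v (x i) * star (v (y i)) else 0

/-- A qubit `q` is separable for `S` if there is an orthonormal basis `{v₀, v₁}` of `H_q`
such that every element of `S` commutes with the projection onto `ℂv₀` at site `q`. -/
def SeparableAt {n : ℕ}
    (S : Finset (Matrix (Fin n → Fin 2) (Fin n → Fin 2) ℂ)) (q : Fin n) : Prop :=
  ∃ v₀ v₁ : Fin 2 → ℂ,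
    star v₀ ⬝ᵥ v₀ = 1 ∧ star v₁ ⬝ᵥ v₁ = 1 ∧ star v₀ ⬝ᵥ v₁ = 0 ∧
    ∀ H ∈ S, Commute H (projAt q v₀)

/-- An instance of `CLH(3,2)`: a finite set of pairwise commuting orthogonal projections on
`n` qubits, each with support of size at most 3. -/
def IsCLH32 {n : ℕ} (S : Finset (Matrix (Fin n → Fin 2) (Fin n → Fin 2) ℂ)) : Prop :=
  (∀ H ∈ S, H.IsHermitian ∧ H * H = H) ∧
  (∀ H ∈ S, ∀ H' ∈ S, Commute H H') ∧
  (∀ H ∈ S, (supp H).ncard ≤ 3)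

/-- The interaction graph of `S`: qubits are adjacent when some operator of `S` acts
nontrivially on both. -/
def interactionGraph {n : ℕ}
    (S : Finset (Matrix (Fin n → Fin 2) (Fin n → Fin 2) ℂ)) : SimpleGraph (Fin n) :=
  SimpleGraph.fromRel (fun i j => ∃ H ∈ S, i ∈ supp H ∧ j ∈ supp H)

/-- An open operator path of length `L` in `S`. -/
def IsOpenOpPath {n : ℕ} (S : Finset (Matrix (Fin n → Fin 2) (Fin n → Fin 2) ℂ))
    {L : ℕ} (P : Fin L → Matrix (Fin n → Fin 2) (Fin n → Fin 2) ℂ) : Prop :=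
  Function.Injective P ∧ (∀ i, P i ∈ S) ∧
  ∀ i k : Fin L,
    (Nat.dist i.1 k.1 = 1 → (supp (P i) ∩ supp (P k)).ncard = 2) ∧
    (Nat.dist i.1 k.1 = 2 → (supp (P i) ∩ supp (P k)).ncard = 1) ∧
    (2 < Nat.dist i.1 k.1 → supp (P i) ∩ supp (P k) = ∅)

/-- The `2 × 2` block of `M` at site `p` with the other row and column indices fixed by `x`
and `y`. -/
def slice {n : ℕ} (p : Fin n) (M : Matrix (Fin n → Fin 2) (Fin n → Fin 2) ℂ)
    (x y : Fin n → Fin 2) : Matrix (Fin 2) (Fin 2) ℂ :=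
  Matrix.of fun s t => M (Function.update x p s) (Function.update y p t)

section Slices

variable {n : ℕ} {p : Fin n} {M H : Matrix (Fin n → Fin 2) (Fin n → Fin 2) ℂ}

lemma update_val_ne (x : Fin n → Fin 2) (p : Fin n) (s : Fin 2) :
    (fun j : {j : Fin n // j ≠ p} => Function.update x p s j.1) = fun j => x j.1 := by
  funext j
  exact Function.update_of_ne j.2 _ _

lemma ActsTriviallyAt.slice_eq (h : ActsTriviallyAt M p) (x y : Fin n → Fin 2) :
    ∃ c : ℂ, slice p M x y = c • 1 := by
  obtain ⟨N, hN⟩ := h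
  refine ⟨N (fun j => x j.1) (fun j => y j.1), ?_⟩
  ext s t
  simp [slice, hN, update_val_ne, Matrix.one_apply]

lemma actsTriviallyAt_of_slice (h : ∀ x y, ∃ c : ℂ, slice p M x y = c • 1) :
    ActsTriviallyAt M p := by
  refine ⟨fun a b => M (fun j => if hj : j ≠ p then a ⟨j, hj⟩ else 0)
    (fun j => if hj : j ≠ p then b ⟨j, hj⟩ else 0), fun x y => ?_⟩
  obtain ⟨c, hc⟩ := h x y
  have hext : ∀ z : Fin n → Fin 2,
      (fun j => if _ : j ≠ p then z j else 0) = Function.update z p 0 := by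
    intro z
    funext j
    by_cases hj : j = p
    · subst hj; simp
    · simp [hj]
  have h0 : M (Function.update x p 0) (Function.update y p 0) = c := by
    simpa [slice] using congrFun (congrFun hc 0) 0
  have h1 : M x y = c * (if x p = y p then 1 else 0) := by
    simpa [slice, Matrix.one_apply] using congrFun (congrFun hc (x p)) (y p)
  simp only [hext, h0, h1]
  ring

/-- A sum over configurations collapses to a sum over the values at a single site `p` when the
summand vanishes off the configurations that agree with `g` away from `p`. -/
lemma sum_eq_sum_update (g : Fin n → Fin 2) (f : (Fin n → Fin 2) → ℂ)
    (hf : ∀ z, z ≠ Function.update g p (z p) → f z = 0) :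
    ∑ z, f z = ∑ u, f (Function.update g p u) := by
  have hinj : Function.Injective (fun u => Function.update g p u) :=
    Function.update_injective g p
  rw [← Finset.sum_image (s := Finset.univ) (f := f) (fun a _ b _ h => hinj h)]
  refine (Finset.sum_subset (Finset.subset_univ _) fun z _ hz => hf z fun h => hz ?_).symm
  exact Finset.mem_image.2 ⟨z p, Finset.mem_univ _, h.symm⟩

lemma commute_projAt_of_slice {v : Fin 2 → ℂ}
    (h : ∀ x y, Commute (slice p M x y) (vecMulVec v (star v))) :
    Commute M (projAt p v) := by
  ext x y
  have hxy := congrFun (congrFun (h x y).eq (x p)) (y p)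
  simp only [Matrix.mul_apply, slice, Matrix.of_apply, vecMulVec_apply, Pi.star_apply,
    Function.update_eq_self] at hxy
  rw [Matrix.mul_apply, Matrix.mul_apply, sum_eq_sum_update (p := p) y,
    sum_eq_sum_update (p := p) x]
  · simpa [projAt] using hxy
  · intro z hz
    have : Function.update x p (z p) ≠ z := fun h => hz h.symm
    simp [projAt, this]
  · intro z hz
    have : Function.update z p (y p) ≠ y := by
      intro h
      apply hz
      conv_rhs => rw [← h]
      simp
    simp [projAt, this]

lemma apply_eq_zero_of_notMem_supp {i : Fin n} (hi : i ∉ supp M) {x y : Fin n → Fin 2}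
    (hxy : x i ≠ y i) : M x y = 0 := by
  obtain ⟨N, hN⟩ := not_not.1 hi
  simp [hN, hxy]

lemma apply_update_of_notMem_supp {i : Fin n} (hi : i ∉ supp M) {x y : Fin n → Fin 2}
    (hxy : x i = y i) (c : Fin 2) :
    M (Function.update x i c) (Function.update y i c) = M x y := by
  obtain ⟨N, hN⟩ := not_not.1 hi
  simp [hN, hxy, update_val_ne]

lemma apply_piecewise_of_disjoint_supp (T : Finset (Fin n)) (hT : ∀ i ∈ T, i ∉ supp M)
    (x y z : Fin n → Fin 2) (hxy : ∀ i ∈ T, x i = y i) :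
    M (T.piecewise z x) (T.piecewise z y) = M x y := by
  induction T using Finset.induction_on with
  | empty => simp
  | insert i T hi ih =>
    rw [Finset.piecewise_insert, Finset.piecewise_insert]
    refine (apply_update_of_notMem_supp (hT i (Finset.mem_insert_self i T)) ?_ _).trans ?_
    · simpa [hi] using hxy i (Finset.mem_insert_self i T)
    · exact ih (fun j hj => hT j (Finset.mem_insert_of_mem hj))
        (fun j hj => hxy j (Finset.mem_insert_of_mem hj))

/-- Entries of an operator depend only on the row and column indices on its support. -/
lemma apply_congr_of_supp {x y x' y' : Fin n → Fin 2}
    (hx : ∀ i ∈ supp M, x i = x' i) (hy : ∀ i ∈ supp M, y i = y' i)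
    (hxy : ∀ i ∉ supp M, x i = y i) (hxy' : ∀ i ∉ supp M, x' i = y' i) :
    M x y = M x' y' := by
  classical
  let T : Finset (Fin n) := {i | i ∉ supp M}
  have hT : ∀ i, i ∈ T ↔ i ∉ supp M := fun i => by simp [T]
  rw [← apply_piecewise_of_disjoint_supp T (fun i hi => (hT i).1 hi) x y x'
    (fun i hi => hxy i ((hT i).1 hi))]
  congr 1 <;> funext i <;> by_cases hi : i ∈ supp M <;> simp_all [Finset.piecewise]

lemma slice_apply_congr {x y x' y' : Fin n → Fin 2}
    (hx : ∀ i ≠ p, i ∈ supp M → x i = x' i) (hy : ∀ i ≠ p, i ∈ supp M → y i = y' i)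
    (hxy : ∀ i ≠ p, i ∉ supp M → x i = y i) (hxy' : ∀ i ≠ p, i ∉ supp M → x' i = y' i)
    (s t : Fin 2) :
    M (Function.update x p s) (Function.update y p t) =
      M (Function.update x' p s) (Function.update y' p t) := by
  by_cases hst : p ∉ supp M ∧ s ≠ t
  · rw [apply_eq_zero_of_notMem_supp hst.1 (by simpa using hst.2),
      apply_eq_zero_of_notMem_supp hst.1 (by simpa using hst.2)]
  · apply apply_congr_of_supp <;> intro i hi <;> by_cases hip : i = p <;> grind

lemma slice_eq_zero_of_ne {x y : Fin n → Fin 2} {i : Fin n} (hip : i ≠ p) (hi : i ∉ supp M)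
    (hxy : x i ≠ y i) : slice p M x y = 0 := by
  ext s t
  exact apply_eq_zero_of_notMem_supp hi (by simpa [hip] using hxy)

/-- If two operators overlap at most in `p`, the product of two of their blocks at `p` is a
block of the product. -/
lemma slice_mul_slice (hsub : supp H ∩ supp M ⊆ {p}) {x y z w X Y : Fin n → Fin 2}
    (hxy : ∀ i ≠ p, i ∉ supp H → x i = y i) (hzw : ∀ i ≠ p, i ∉ supp M → z i = w i)
    (hXH : ∀ i ≠ p, i ∈ supp H → X i = x i) (hXM : ∀ i ≠ p, i ∈ supp M → X i = z i)
    (hYH : ∀ i ≠ p, i ∈ supp H → Y i = y i) (hYM : ∀ i ≠ p, i ∈ supp M → Y i = w i)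
    (hXY : ∀ i ≠ p, i ∉ supp H → i ∉ supp M → X i = Y i) :
    slice p H x y * slice p M z w = slice p (H * M) X Y := by
  classical
  have hdisj : ∀ i ≠ p, i ∈ supp H → i ∉ supp M := fun i hi h1 h2 => hi (hsub ⟨h1, h2⟩)
  let g : Fin n → Fin 2 := fun i => if i ∈ supp H then Y i else X i
  have hgH : ∀ i ∈ supp H, g i = Y i := fun i hi => if_pos hi
  have hgX : ∀ i ∉ supp H, g i = X i := fun i hi => if_neg hi
  clear_value g
  ext s t
  simp only [slice, Matrix.mul_apply, Matrix.of_apply]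
  rw [sum_eq_sum_update (p := p) g]
  · refine Finset.sum_congr rfl fun u _ => ?_
    have hH : ∀ i ≠ p, i ∉ supp H → X i = g i := fun i _ hi => (hgX i hi).symm
    have hM : ∀ i ≠ p, i ∉ supp M → g i = Y i := by grind
    have hgY : ∀ i ≠ p, i ∈ supp H → y i = g i := by grind
    have hgM : ∀ i ≠ p, i ∈ supp M → z i = g i := by grind
    congr 1
    · exact slice_apply_congr (fun i h h' => (hXH i h h').symm) hgY hxy hH s u
    · exact slice_apply_congr hgM (fun i h h' => (hYM i h h').symm) hzw hM u t
  · intro Z hZ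
    obtain ⟨i, hi⟩ := Function.ne_iff.1 hZ
    have hip : i ≠ p := by
      rintro rfl
      simp at hi
    rw [Function.update_of_ne hip] at hi
    by_cases hiH : i ∈ supp H
    · rw [apply_eq_zero_of_notMem_supp (hdisj i hip hiH), mul_zero]
      rwa [Function.update_of_ne hip, ← hgH i hiH]
    · rw [apply_eq_zero_of_notMem_supp hiH, zero_mul]
      rw [Function.update_of_ne hip, ← hgX i hiH]
      exact hi.symm

/-- Commuting operators that overlap at most in `p` have commuting blocks at `p`. -/
lemma commute_slice (hcomm : Commute H M) (hsub : supp H ∩ supp M ⊆ {p})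
    (x y z w : Fin n → Fin 2) : Commute (slice p H x y) (slice p M z w) := by
  classical
  by_cases hxy : ∀ i ≠ p, i ∉ supp H → x i = y i
  swap
  · push Not at hxy
    obtain ⟨i, hip, hi, hne⟩ := hxy
    rw [slice_eq_zero_of_ne hip hi hne]
    exact Commute.zero_left _
  by_cases hzw : ∀ i ≠ p, i ∉ supp M → z i = w i
  swap
  · push Not at hzw
    obtain ⟨i, hip, hi, hne⟩ := hzw
    rw [slice_eq_zero_of_ne hip hi hne]
    exact Commute.zero_right _
  have hdisj : ∀ i ≠ p, i ∈ supp M → i ∉ supp H := fun i hi h1 h2 => hi (hsub ⟨h2, h1⟩)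
  let X : Fin n → Fin 2 := fun i => if i ∈ supp H then x i else z i
  let Y : Fin n → Fin 2 := fun i => if i ∈ supp H then y i else w i
  have hXH : ∀ i ≠ p, i ∈ supp H → X i = x i := fun i _ hi => if_pos hi
  have hXM : ∀ i ≠ p, i ∈ supp M → X i = z i := fun i hip hi => if_neg (hdisj i hip hi)
  have hYH : ∀ i ≠ p, i ∈ supp H → Y i = y i := fun i _ hi => if_pos hi
  have hYM : ∀ i ≠ p, i ∈ supp M → Y i = w i := fun i hip hi => if_neg (hdisj i hip hi)
  have hXY : ∀ i ≠ p, i ∉ supp H → i ∉ supp M → X i = Y i := fun i hip hi hi' => by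
    simpa [X, Y, hi] using hzw i hip hi'
  rw [Commute, SemiconjBy, slice_mul_slice hsub hxy hzw hXH hXM hYH hYM hXY,
    slice_mul_slice (by rwa [Set.inter_comm]) hzw hxy hXM hXH hYM hYH
      (fun i hip hi hi' => hXY i hip hi' hi), hcomm.eq]

lemma Matrix.IsHermitian.conjTranspose_slice (hM : M.IsHermitian) (x y : Fin n → Fin 2) :
    (slice p M x y)ᴴ = slice p M y x := by
  ext s t
  exact hM.apply _ _

end Slices

/-- The commutant of a non-scalar `2 × 2` matrix is commutative. -/
lemma Matrix.commute_of_commute_nonscalar {a b c : Matrix (Fin 2) (Fin 2) ℂ}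
    (hb : ¬ ∃ r : ℂ, b = r • 1) (hab : Commute a b) (hcb : Commute c b) : Commute a c := by
  have ha := hab.eq
  have hc := hcb.eq
  rw [← Matrix.ext_iff] at ha hc
  simp only [Fin.forall_fin_two, Matrix.mul_apply, Fin.sum_univ_two] at ha hc
  obtain ⟨⟨a1, a2⟩, a3, -⟩ := ha
  obtain ⟨⟨c1, c2⟩, c3, -⟩ := hc
  have key : ∀ d : ℂ, d * b 0 1 = 0 → d * b 1 0 = 0 → d * (b 0 0 - b 1 1) = 0 → d = 0 := by
    intro d h1 h2 h3
    by_contra hd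
    refine hb ⟨b 0 0, ?_⟩
    have e1 := (mul_eq_zero.1 h1).resolve_left hd
    have e2 := (mul_eq_zero.1 h2).resolve_left hd
    have e3 := (mul_eq_zero.1 h3).resolve_left hd
    ext i j
    fin_cases i <;> fin_cases j <;> simp [e1, e2]
    linear_combination -e3
  have k1 : a 0 1 * c 1 0 - a 1 0 * c 0 1 = 0 := by
    apply key <;> grind
  have k2 : a 0 1 * (c 0 0 - c 1 1) - (a 0 0 - a 1 1) * c 0 1 = 0 := by
    apply key <;> grind
  have k3 : a 1 0 * (c 0 0 - c 1 1) - (a 0 0 - a 1 1) * c 1 0 = 0 := by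
    apply key <;> grind
  ext i j
  fin_cases i <;> fin_cases j <;> simp [Matrix.mul_apply, Fin.sum_univ_two]
  · linear_combination k1
  · linear_combination -k2
  · linear_combination k3
  · linear_combination -k1

/-- A Hermitian `2 × 2` matrix commutes with the projections of an orthonormal basis. -/
lemma Matrix.IsHermitian.exists_commute_vecMulVec {b : Matrix (Fin 2) (Fin 2) ℂ}
    (hb : b.IsHermitian) : ∃ v₀ v₁ : Fin 2 → ℂ, star v₀ ⬝ᵥ v₀ = 1 ∧ star v₁ ⬝ᵥ v₁ = 1 ∧
      star v₀ ⬝ᵥ v₁ = 0 ∧ Commute (vecMulVec v₀ (star v₀)) b := by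
  have horth : ∀ i j, star (hb.eigenvectorBasis i).ofLp ⬝ᵥ (hb.eigenvectorBasis j).ofLp =
      if i = j then 1 else 0 := by
    intro i j
    rw [← orthonormal_iff_ite.1 hb.eigenvectorBasis.orthonormal i j, dotProduct_comm]
    rfl
  refine ⟨(hb.eigenvectorBasis 0).ofLp, (hb.eigenvectorBasis 1).ofLp, by simp [horth],
    by simp [horth], by simp [horth], ?_⟩
  have h1 := hb.mulVec_eigenvectorBasis 0
  have h2 := congrArg star h1
  rw [star_mulVec, hb.eq] at h2
  rw [Commute, SemiconjBy, vecMulVec_mul, mul_vecMulVec, h1, h2]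
  ext i j
  simp [vecMulVec_apply]
  ring

/-- A non-scalar `2 × 2` matrix has a non-scalar Hermitian combination of itself and its
adjoint. -/
lemma Matrix.exists_isHermitian_nonscalar {a : Matrix (Fin 2) (Fin 2) ℂ}
    (ha : ¬ ∃ r : ℂ, a = r • 1) : ∃ b : Matrix (Fin 2) (Fin 2) ℂ, b.IsHermitian ∧
      (¬ ∃ r : ℂ, b = r • 1) ∧ ∀ m, Commute m a → Commute m aᴴ → Commute m b := by
  by_cases h1 : ∃ r : ℂ, a + aᴴ = r • 1
  · refine ⟨Complex.I • (a - aᴴ), ?_, ?_, fun m h h' => (h.sub_right h').smul_right _⟩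
    · rw [Matrix.IsHermitian, conjTranspose_smul, conjTranspose_sub, conjTranspose_conjTranspose]
      rw [Complex.star_def, Complex.conj_I, neg_smul, ← smul_neg, neg_sub]
    · rintro ⟨s, hs⟩
      obtain ⟨r, hr⟩ := h1
      refine ha ⟨(r - Complex.I * s) / 2, ?_⟩
      have h2 : a - aᴴ = (-Complex.I * s) • 1 := by
        rw [mul_smul, ← hs, smul_smul]
        simp
      have h3 : (2 : ℂ) • a = (r - Complex.I * s) • 1 := by
        have : (2 : ℂ) • a = (a + aᴴ) + (a - aᴴ) := by rw [two_smul]; abel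
        rw [this, hr, h2, ← add_smul]
        ring_nf
      rw [div_eq_inv_mul, mul_smul, ← h3, smul_smul]
      simp
  · exact ⟨a + aᴴ, isHermitian_add_transpose_self a, h1, fun m h h' => h.add_right h'⟩

section Separability

variable {n : ℕ} {S : Finset (Matrix (Fin n → Fin 2) (Fin n → Fin 2) ℂ)}

lemma exists_slice_nonscalar {M : Matrix (Fin n → Fin 2) (Fin n → Fin 2) ℂ} {p : Fin n}
    (hp : p ∈ supp M) : ∃ x y, ¬ ∃ r : ℂ, slice p M x y = r • 1 := by
  by_contra! h
  exact hp (actsTriviallyAt_of_slice h)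

lemma commute_slice_of_notMem_supp {M : Matrix (Fin n → Fin 2) (Fin n → Fin 2) ℂ} {p : Fin n}
    (hp : p ∉ supp M) (x y : Fin n → Fin 2) (a : Matrix (Fin 2) (Fin 2) ℂ) :
    Commute (slice p M x y) a := by
  obtain ⟨c, hc⟩ := (not_not.1 hp : ActsTriviallyAt M p).slice_eq x y
  rw [hc]
  exact (Commute.one_left a).smul_left c

/-- Some operator acts nontrivially on a non-separable qubit. -/
lemma exists_mem_supp_of_not_separableAt {q : Fin n} (hq : ¬ SeparableAt S q) :
    ∃ H ∈ S, q ∈ supp H := by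
  by_contra! h
  obtain ⟨v₀, v₁, h0, h1, h01, -⟩ :=
    (Matrix.isHermitian_one (n := Fin 2) (α := ℂ)).exists_commute_vecMulVec
  exact hq ⟨v₀, v₁, h0, h1, h01, fun H hH => commute_projAt_of_slice fun x y =>
    commute_slice_of_notMem_supp (h H hH) x y _⟩

lemma inter_subset_singleton {A B : Set (Fin n)} {p : Fin n} (hA : p ∈ A) (hB : p ∈ B)
    (h : (A ∩ B).ncard < 2) : A ∩ B ⊆ {p} := fun _ hi =>
  Set.ncard_le_one (Set.toFinite _) |>.1 (by omega) _ hi _ ⟨hA, hB⟩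

/-- Two operators that meet only in a non-separable qubit are bridged by an operator meeting
each of them in at least two qubits. -/
lemma exists_bridge (hS : IsCLH32 S) {p : Fin n} (hsep : ¬ SeparableAt S p)
    {H K : Matrix (Fin n → Fin 2) (Fin n → Fin 2) ℂ} (hH : H ∈ S) (hK : K ∈ S)
    (hpH : p ∈ supp H) (hpK : p ∈ supp K) (hHK : (supp H ∩ supp K).ncard < 2) :
    ∃ M ∈ S, 2 ≤ (supp H ∩ supp M).ncard ∧ 2 ≤ (supp M ∩ supp K).ncard := by
  obtain ⟨hproj, hcomm, -⟩ := hS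
  by_contra! hno
  obtain ⟨x, y, ha⟩ := exists_slice_nonscalar hpH
  obtain ⟨z, w, hc⟩ := exists_slice_nonscalar hpK
  obtain ⟨b, hbherm, hb, hbcomm⟩ := Matrix.exists_isHermitian_nonscalar ha
  rw [(hproj H hH).1.conjTranspose_slice] at hbcomm
  obtain ⟨v₀, v₁, h0, h1, h01, hv⟩ := hbherm.exists_commute_vecMulVec
  refine hsep ⟨v₀, v₁, h0, h1, h01, fun M hM => commute_projAt_of_slice fun x' y' => ?_⟩
  by_cases hpM : p ∈ supp M
  swap
  · exact commute_slice_of_notMem_supp hpM _ _ _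
  refine Matrix.commute_of_commute_nonscalar hb ?_ hv
  have overlap : ∀ M' ∈ S, p ∈ supp M' → (supp H ∩ supp M').ncard < 2 → ∀ s t,
      Commute (slice p M' s t) b := fun M' hM' hpM' hlt s t =>
    hbcomm _
      (commute_slice (hcomm H hH M' hM') (inter_subset_singleton hpH hpM' hlt) ..).symm
      (commute_slice (hcomm H hH M' hM') (inter_subset_singleton hpH hpM' hlt) ..).symm
  by_cases hHM : 2 ≤ (supp H ∩ supp M).ncard
  · exact Matrix.commute_of_commute_nonscalar hc
      (commute_slice (hcomm M hM K hK) (inter_subset_singleton hpM hpK (hno M hM hHM)) ..)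
      (overlap K hK hpK hHK z w).symm
  · exact overlap M hM hpM (by omega) x' y'

end Separability

/-- The graph on the operators of `S` in which two operators are adjacent when their supports
share at least two qubits. -/
def overlapGraph {n : ℕ} (S : Finset (Matrix (Fin n → Fin 2) (Fin n → Fin 2) ℂ)) :
    SimpleGraph S where
  Adj H K := H ≠ K ∧ 2 ≤ (supp H.1 ∩ supp K.1).ncard
  symm := ⟨fun _ _ h => ⟨h.1.symm, by rw [Set.inter_comm]; exact h.2⟩⟩
  loopless := ⟨fun _ h => h.1 rfl⟩

section OverlapGraph

variable {n : ℕ} {S : Finset (Matrix (Fin n → Fin 2) (Fin n → Fin 2) ℂ)}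

lemma overlapGraph_exists_walk_one {H K : S} (h : 2 ≤ (supp H.1 ∩ supp K.1).ncard) :
    ∃ w : (overlapGraph S).Walk H K, w.length ≤ 1 := by
  by_cases hHK : H = K
  · subst hHK
    exact ⟨.nil, by simp⟩
  · have hadj : (overlapGraph S).Adj H K := ⟨hHK, h⟩
    exact ⟨hadj.toWalk, hadj.length_toWalk.le⟩

lemma overlapGraph_exists_walk_two (hS : IsCLH32 S) (hsep : ∀ q, ¬ SeparableAt S q) {H K : S}
    (h : (supp H.1 ∩ supp K.1).Nonempty) :
    ∃ w : (overlapGraph S).Walk H K, w.length ≤ 2 := by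
  by_cases h2 : 2 ≤ (supp H.1 ∩ supp K.1).ncard
  · obtain ⟨w, hw⟩ := overlapGraph_exists_walk_one h2
    exact ⟨w, by omega⟩
  · obtain ⟨p, hpH, hpK⟩ := h
    obtain ⟨M, hM, hHM, hMK⟩ := exists_bridge hS (hsep p) H.2 K.2 hpH hpK (by omega)
    obtain ⟨w, hw⟩ := overlapGraph_exists_walk_one (H := H) (K := ⟨M, hM⟩) hHM
    obtain ⟨w', hw'⟩ := overlapGraph_exists_walk_one (H := ⟨M, hM⟩) (K := K) hMK
    exact ⟨w.append w', by rw [SimpleGraph.Walk.length_append]; omega⟩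

/-- Operators acting on the two ends of a walk in the interaction graph are joined by a walk in
the overlap graph. -/
lemma overlapGraph_reachable (hS : IsCLH32 S) (hsep : ∀ q, ¬ SeparableAt S q)
    {q v : Fin n} (w : (interactionGraph S).Walk q v) :
    ∀ {H K : S}, q ∈ supp H.1 → v ∈ supp K.1 → (overlapGraph S).Reachable H K := by
  have meet : ∀ {H K : S} {p}, p ∈ supp H.1 → p ∈ supp K.1 →
      (overlapGraph S).Reachable H K := fun hH hK =>
    (overlapGraph_exists_walk_two hS hsep ⟨_, hH, hK⟩).choose.reachable
  induction w with
  | nil => exact meet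
  | cons hadj _ ih =>
    intro H K hq hv
    obtain ⟨-, ⟨M, hM, h1, h2⟩ | ⟨M, hM, h2, h1⟩⟩ := (SimpleGraph.fromRel_adj _ _ _).1 hadj
    all_goals exact (meet (K := ⟨M, hM⟩) hq h1).trans (ih (H := ⟨M, hM⟩) h2 hv)

/-- Three sets `A`, `B`, `C` with `|B| ≤ 3` and `A`, `C` each sharing two elements with `B`
satisfy `A ∩ C ≠ ∅`. -/
lemma inter_nonempty_of_two_le_ncard {A B C : Set (Fin n)} (hB : B.ncard ≤ 3)
    (hAB : 2 ≤ (A ∩ B).ncard) (hBC : 2 ≤ (B ∩ C).ncard) : (A ∩ C).Nonempty := by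
  by_contra hempty
  rw [Set.not_nonempty_iff_eq_empty] at hempty
  have hdisj : Disjoint (A ∩ B) (B ∩ C) := by
    rw [Set.disjoint_left]
    intro i h1 h2
    have : i ∈ A ∩ C := ⟨h1.1, h2.2⟩
    rw [hempty] at this
    exact this
  have h1 := Set.ncard_union_eq hdisj (Set.toFinite _) (Set.toFinite _)
  have h2 : ((A ∩ B) ∪ (B ∩ C)).ncard ≤ B.ncard :=
    Set.ncard_le_ncard (by grind) (Set.toFinite _)
  omega

lemma eq_of_three_le_ncard_inter {A B : Set (Fin n)} (hA : A.ncard ≤ 3) (hB : B.ncard ≤ 3)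
    (h : 3 ≤ (A ∩ B).ncard) : A = B := by
  have h1 := Set.eq_of_subset_of_ncard_le (Set.inter_subset_left (s := A) (t := B))
    (by omega) (Set.toFinite _)
  have h2 := Set.eq_of_subset_of_ncard_le (Set.inter_subset_right (s := A) (t := B))
    (by omega) (Set.toFinite _)
  exact h1.symm.trans h2

end OverlapGraph

/-- Claim 4.11.  In an instance `S` of `CLH(3,2)` with no separable qubits
and connected interaction graph, the particles are operator-path-connected: any two qubits
`q` and `v` are linked by an open operator path whose first operator acts nontrivially on `q`
and whose last operator acts nontrivially on `v`. -/
theorem connectivity_implies_operator_path_connectivity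
    {n : ℕ} (S : Finset (Matrix (Fin n → Fin 2) (Fin n → Fin 2) ℂ))
    (hclh : IsCLH32 S)
    (hnosep : ∀ q : Fin n, ¬ SeparableAt S q)
    (hconn : (interactionGraph S).Connected) :
    ∀ q v : Fin n, ∃ (L : ℕ) (P : Fin (L + 1) → Matrix (Fin n → Fin 2) (Fin n → Fin 2) ℂ),
      IsOpenOpPath S P ∧ q ∈ supp (P 0) ∧ v ∈ supp (P (Fin.last L)) := by
  classical
  intro q v
  have hex : ∃ (L : ℕ) (H K : S) (w : (overlapGraph S).Walk H K),
      q ∈ supp H.1 ∧ v ∈ supp K.1 ∧ w.length = L := by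
    obtain ⟨H, hH, hq⟩ := exists_mem_supp_of_not_separableAt (hnosep q)
    obtain ⟨K, hK, hv⟩ := exists_mem_supp_of_not_separableAt (hnosep v)
    obtain ⟨w⟩ := hconn.preconnected q v
    obtain ⟨w'⟩ := overlapGraph_reachable hclh hnosep w (H := ⟨H, hH⟩) (K := ⟨K, hK⟩) hq hv
    exact ⟨_, _, _, w', hq, hv, rfl⟩
  let L := Nat.find hex
  obtain ⟨H, K, w, hq, hv, hwL⟩ : ∃ (H K : S) (w : (overlapGraph S).Walk H K),
    q ∈ supp H.1 ∧ v ∈ supp K.1 ∧ w.length = L := Nat.find_spec hex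
  have hmin : ∀ {H' K' : S} (w' : (overlapGraph S).Walk H' K'), q ∈ supp H'.1 →
      v ∈ supp K'.1 → L ≤ w'.length := fun w' hq' hv' =>
    Nat.find_min' hex ⟨_, _, w', hq', hv', rfl⟩
  have hgeo : ∀ {i k : ℕ}, i ≤ k → k ≤ L →
      ∀ w' : (overlapGraph S).Walk (w.getVert i) (w.getVert k), k ≤ i + w'.length := by
    intro i k hik hk w'
    have := hmin (((w.take i).append w').append (w.drop k)) hq hv
    simp only [SimpleGraph.Walk.length_append, SimpleGraph.Walk.take_length,
      SimpleGraph.Walk.drop_length] at this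
    omega
  have hcard : ∀ A : S, (supp A.1).ncard ≤ 3 := fun A => hclh.2.2 A.1 A.2
  have hadj : ∀ {i}, i < L → (overlapGraph S).Adj (w.getVert i) (w.getVert (i + 1)) :=
    fun hi => w.adj_getVert_succ (by omega)
  have hfar : ∀ {i k : ℕ}, i + 2 ≤ k → k ≤ L →
      (supp (w.getVert i).1 ∩ supp (w.getVert k).1).ncard < 2 := by
    intro i k hik hk
    by_contra! h
    obtain ⟨w', hw'⟩ := overlapGraph_exists_walk_one h
    have := hgeo (by omega) hk w'
    omega
  have hone : ∀ {i : ℕ}, i + 1 ≤ L →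
      (supp (w.getVert i).1 ∩ supp (w.getVert (i + 1)).1).ncard = 2 := by
    intro i hi
    have h2 := (hadj hi).2
    by_contra hne
    have heq := eq_of_three_le_ncard_inter (hcard (w.getVert i)) (hcard (w.getVert (i + 1)))
      (by omega)
    rcases i with _ | i
    · have := hmin (w.drop 1) (by rw [← heq, SimpleGraph.Walk.getVert_zero]; exact hq) hv
      rw [SimpleGraph.Walk.drop_length] at this
      omega
    · have h3 := hfar (le_refl (i + 2)) hi
      rw [← heq] at h3
      have h4 := (hadj (i := i) (by omega)).2
      omega
  have htwo : ∀ {i : ℕ}, i + 2 ≤ L →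
      (supp (w.getVert i).1 ∩ supp (w.getVert (i + 2)).1).ncard = 1 := by
    intro i hi
    have h1 := inter_nonempty_of_two_le_ncard (hcard (w.getVert (i + 1)))
      (hadj (i := i) (by omega)).2 (hadj (i := i + 1) (by omega)).2
    have h2 : 0 < (supp (w.getVert i).1 ∩ supp (w.getVert (i + 2)).1).ncard :=
      (Set.ncard_pos (Set.toFinite _)).2 h1
    have h3 := hfar (le_refl (i + 2)) hi
    omega
  have hthree : ∀ {i k : ℕ}, i + 2 < k → k ≤ L →
      supp (w.getVert i).1 ∩ supp (w.getVert k).1 = ∅ := by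
    intro i k hik hk
    by_contra h
    obtain ⟨w', hw'⟩ := overlapGraph_exists_walk_two hclh hnosep
      (Set.nonempty_iff_ne_empty.2 h)
    have := hgeo (by omega) hk w'
    omega
  refine ⟨L, fun i => (w.getVert i).1, ⟨?_, fun i => (w.getVert i).2, ?_⟩, ?_, ?_⟩
  · have hinj : ∀ {i k : ℕ}, i ≤ k → k ≤ L → w.getVert i = w.getVert k → i = k := by
      intro i k hik hk h
      have := hgeo hik hk (SimpleGraph.Walk.nil.copy rfl h)
      simp only [SimpleGraph.Walk.length_copy, SimpleGraph.Walk.length_nil] at this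
      omega
    intro i k hik
    have h := Subtype.ext hik
    apply Fin.ext
    rcases le_total i.1 k.1 with hle | hle
    · exact hinj hle (by omega) h
    · exact (hinj hle (by omega) h.symm).symm
  · intro i k
    wlog hle : i ≤ k generalizing i k
    · simpa only [Nat.dist_comm, Set.inter_comm] using this k i (le_of_not_ge hle)
    obtain ⟨i, hi⟩ := i
    obtain ⟨k, hk⟩ := k
    have hle' : i ≤ k := hle
    simp only [Nat.dist_eq_sub_of_le hle']
    refine ⟨fun h => ?_, fun h => ?_, fun h => hthree (by omega) (by omega)⟩
    · obtain rfl : k = i + 1 := by omega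
      exact hone (by omega)
    · obtain rfl : k = i + 2 := by omega
      exact htwo (by omega)
  · simpa using hq
  · have : w.getVert L = K := by rw [← hwL, SimpleGraph.Walk.getVert_length]
    simpa [this] using hv
end

section
/- Let S be an instance of CLH(3,2) and let q be a qubit that is not separable for S. Suppose H₁, H₂, H₃, H₄ is an open operator path on q of length 4 with supports A_{H₁} = {q,a₁,a₂}, A_{H₂} = {q,a₂,a₃}, A_{H₃} = {q,a₃,a₄}, A_{H₄} = {q,a₄,a₅} for pairwise distinct particles q, a₁, …, a₅. Then there exists an operator H ∈ S with support A_H = {q, a₂, a₄}. (Claim 4.15, the Bridge Claim.) -/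
open Matrix

/-- An operator path on the qubit `q` of length `L`: `L` distinct operators of `S`, all
acting nontrivially on `q`, consecutive supports intersecting in two particles, and
non-consecutive supports intersecting exactly in `{q}`. -/
def IsOpPathOn {n : ℕ} (S : Finset (Matrix (Fin n → Fin 2) (Fin n → Fin 2) ℂ)) (q : Fin n)
    {L : ℕ} (P : Fin L → Matrix (Fin n → Fin 2) (Fin n → Fin 2) ℂ) : Prop :=
  Function.Injective P ∧ (∀ i, P i ∈ S) ∧ (∀ i, q ∈ supp (P i)) ∧
  (∀ i k : Fin L, Nat.dist i.1 k.1 = 1 → (supp (P i) ∩ supp (P k)).ncard = 2) ∧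
  (∀ i k : Fin L, 2 ≤ Nat.dist i.1 k.1 → supp (P i) ∩ supp (P k) = {q})

/-- The `2 × 2` block of `M` at site `q` between the configurations `x` and `y` of the other
qubits. -/
def siteBlock {n : ℕ} (M : Matrix (Fin n → Fin 2) (Fin n → Fin 2) ℂ) (q : Fin n)
    (x y : Fin n → Fin 2) : Matrix (Fin 2) (Fin 2) ℂ :=
  Matrix.of fun s t => M (Function.update x q s) (Function.update y q t)

/-- Every block of `M` at site `q` commutes with `L`. -/
def BlocksCommute {n : ℕ} (M : Matrix (Fin n → Fin 2) (Fin n → Fin 2) ℂ) (q : Fin n)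
    (L : Matrix (Fin 2) (Fin 2) ℂ) : Prop :=
  ∀ x y, Commute (siteBlock M q x y) L

lemma fin_two_commute_iff (A B : Matrix (Fin 2) (Fin 2) ℂ) :
    Commute A B ↔ A 0 1 * B 1 0 = B 0 1 * A 1 0 ∧
      A 0 1 * (B 1 1 - B 0 0) = B 0 1 * (A 1 1 - A 0 0) ∧
      A 1 0 * (B 1 1 - B 0 0) = B 1 0 * (A 1 1 - A 0 0) := by
  rw [commute_iff_eq, ← Matrix.ext_iff]
  simp only [Fin.forall_fin_two, Matrix.mul_apply, Fin.sum_univ_two]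
  constructor
  · rintro ⟨⟨h1, h2⟩, h3, h4⟩
    exact ⟨by linear_combination h1, by linear_combination h2, by linear_combination -h3⟩
  · rintro ⟨h1, h2, h3⟩
    exact ⟨⟨by linear_combination h1, by linear_combination h2⟩,
      by linear_combination -h3, by linear_combination -h1⟩

/-- A `2 × 2` matrix is scalar when it is diagonal with equal diagonal entries. -/
def IsScalarTwo (A : Matrix (Fin 2) (Fin 2) ℂ) : Prop :=
  A 0 1 = 0 ∧ A 1 0 = 0 ∧ A 1 1 - A 0 0 = 0

lemma IsScalarTwo.commute {A : Matrix (Fin 2) (Fin 2) ℂ} (hA : IsScalarTwo A)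
    (B : Matrix (Fin 2) (Fin 2) ℂ) : Commute A B := by
  obtain ⟨h1, h2, h3⟩ := hA
  rw [fin_two_commute_iff, h1, h2, h3]
  simp

/-- Commutation of `2 × 2` matrices is transitive through a non-scalar matrix. -/
lemma commute_trans_of_not_isScalarTwo {A B C : Matrix (Fin 2) (Fin 2) ℂ}
    (hA : ¬ IsScalarTwo A) (hB : Commute B A) (hC : Commute A C) : Commute B C := by
  rw [fin_two_commute_iff] at *
  obtain ⟨b1, b2, b3⟩ := hB
  obtain ⟨c1, c2, c3⟩ := hC
  unfold IsScalarTwo at hA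
  generalize A 1 1 - A 0 0 = a at *
  generalize B 1 1 - B 0 0 = b at *
  generalize C 1 1 - C 0 0 = c at *
  grind

lemma ActsTriviallyAt.apply_eq_zero {n : ℕ} {M : Matrix (Fin n → Fin 2) (Fin n → Fin 2) ℂ}
    {i : Fin n} (h : ActsTriviallyAt M i) {x y : Fin n → Fin 2} (hxy : x i ≠ y i) :
    M x y = 0 := by
  obtain ⟨N, hN⟩ := h
  simp [hN, hxy]

lemma ActsTriviallyAt.apply_update {n : ℕ} {M : Matrix (Fin n → Fin 2) (Fin n → Fin 2) ℂ}
    {i : Fin n} (h : ActsTriviallyAt M i) {x y : Fin n → Fin 2} (hxy : x i = y i)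
    (s : Fin 2) : M (Function.update x i s) (Function.update y i s) = M x y := by
  obtain ⟨N, hN⟩ := h
  have hu : ∀ z : Fin n → Fin 2,
      (fun j : {j : Fin n // j ≠ i} => Function.update z i s j.1) = fun j => z j.1 :=
    fun z => funext fun j => Function.update_of_ne j.2 _ _
  simp [hN, hxy, hu]

lemma exists_not_isScalarTwo_siteBlock {n : ℕ}
    {M : Matrix (Fin n → Fin 2) (Fin n → Fin 2) ℂ} {q : Fin n} (hq : q ∈ supp M) :
    ∃ x y, ¬ IsScalarTwo (siteBlock M q x y) := by
  by_contra! hsc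
  refine hq ⟨Matrix.of fun x y =>
    M (fun j => if h : j ≠ q then x ⟨j, h⟩ else 0)
      (fun j => if h : j ≠ q then y ⟨j, h⟩ else 0), fun x y => ?_⟩
  have he : ∀ z : Fin n → Fin 2,
      (fun j => if _ : j ≠ q then z j else 0) = Function.update z q 0 := by
    intro z
    funext j
    by_cases h : j = q
    · subst h; simp
    · simp [h]
  obtain ⟨h1, h2, h3⟩ := hsc x y
  simp only [siteBlock, Matrix.of_apply, sub_eq_zero] at h1 h2 h3
  simp only [Matrix.of_apply, he]
  rw [← Function.update_eq_self q x, ← Function.update_eq_self q y]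
  generalize x q = s at *
  generalize y q = t at *
  fin_cases s <;> fin_cases t <;> simp [h1, h2, h3]

lemma mem_supp_of_not_blocksCommute {n : ℕ}
    {M : Matrix (Fin n → Fin 2) (Fin n → Fin 2) ℂ} {q : Fin n}
    {L : Matrix (Fin 2) (Fin 2) ℂ} (h : ¬ BlocksCommute M q L) : q ∈ supp M := by
  intro ht
  refine h fun x y => IsScalarTwo.commute ⟨?_, ?_, ?_⟩ L
  · exact ht.apply_eq_zero (by simp)
  · exact ht.apply_eq_zero (by simp)
  · have := ht.apply_update (x := Function.update x q 0) (y := Function.update y q 0)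
      (by simp) 1
    simpa [siteBlock, sub_eq_zero] using this

/-- Entries of `M` between configurations agreeing off `A ⊇ supp M` depend only on the
restrictions to `A`. -/
lemma apply_congr_of_supp_subset {n : ℕ} {M : Matrix (Fin n → Fin 2) (Fin n → Fin 2) ℂ}
    {A : Set (Fin n)} (hA : supp M ⊆ A) {x y x' y' : Fin n → Fin 2}
    (hx : ∀ i ∈ A, x i = x' i) (hy : ∀ i ∈ A, y i = y' i)
    (hxy : ∀ i ∉ A, x i = y i) (hxy' : ∀ i ∉ A, x' i = y' i) : M x y = M x' y' := by
  classical
  have key : ∀ T : Finset (Fin n), (∀ i ∈ T, i ∉ A) →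
      M (T.piecewise x' x) (T.piecewise y' y) = M x y := by
    intro T
    induction T using Finset.induction_on with
    | empty => simp
    | insert i T hi ih =>
      intro hT
      have hiA := hT i (Finset.mem_insert_self i T)
      have ht : ActsTriviallyAt M i := not_not.mp fun h => hiA (hA h)
      rw [Finset.piecewise_insert, Finset.piecewise_insert, hxy' i hiA, ht.apply_update,
        ih fun j hj => hT j (Finset.mem_insert_of_mem hj)]
      simp [hi, hxy i hiA]
  have hp : ∀ z z' : Fin n → Fin 2, (∀ i ∈ A, z i = z' i) →
      (Finset.univ.filter (· ∉ A)).piecewise z' z = z' := by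
    intro z z' h
    funext i
    by_cases hi : i ∈ A <;> simp [Finset.piecewise, hi, h]
  rw [← key (Finset.univ.filter (· ∉ A)) (by simp), hp x x' hx, hp y y' hy]

lemma apply_eq_zero_of_ne {n : ℕ} {M : Matrix (Fin n → Fin 2) (Fin n → Fin 2) ℂ}
    {x y : Fin n → Fin 2} {i : Fin n} (hi : i ∉ supp M) (hxy : x i ≠ y i) : M x y = 0 :=
  (not_not.mp hi : ActsTriviallyAt M i).apply_eq_zero hxy

/-- A sum over configurations concentrated on those agreeing with `m₀` off `q`. -/
lemma sum_eq_sum_update_s12 {n : ℕ} (q : Fin n) (m₀ : Fin n → Fin 2) (f : (Fin n → Fin 2) → ℂ)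
    (hf : ∀ m, ∀ i ≠ q, m i ≠ m₀ i → f m = 0) :
    ∑ m, f m = ∑ r, f (Function.update m₀ q r) := by
  classical
  rw [← Finset.sum_image (s := Finset.univ) (g := Function.update m₀ q) (f := f)
    (Function.update_injective m₀ q).injOn]
  refine (Finset.sum_subset (Finset.subset_univ _) fun m _ hm => ?_).symm
  by_contra hne
  refine hm (Finset.mem_image.mpr ⟨m q, Finset.mem_univ _, ?_⟩)
  funext i
  by_cases hi : i = q
  · subst hi; simp
  · rw [Function.update_of_ne hi]
    by_contra h
    exact hne (hf m i hi fun h' => h h'.symm)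

/-- If `x` and `y` differ at a site `i ≠ q` off the support, the block of `M` vanishes. -/
lemma siteBlock_eq_zero {n : ℕ} {M : Matrix (Fin n → Fin 2) (Fin n → Fin 2) ℂ}
    {q i : Fin n} {x y : Fin n → Fin 2} (hi : i ∉ supp M) (hiq : i ≠ q) (hxy : x i ≠ y i) :
    siteBlock M q x y = 0 := by
  ext s t
  exact apply_eq_zero_of_ne hi (by simpa [hiq] using hxy)

/-- Product of two operators whose supports meet only in `q`, evaluated on glued
configurations, is the product of their blocks at `q`. -/
lemma mul_apply_glue {n : ℕ} {M M' : Matrix (Fin n → Fin 2) (Fin n → Fin 2) ℂ} {q : Fin n}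
    (hint : supp M ∩ supp M' ⊆ {q}) {x y z w u v : Fin n → Fin 2}
    (hxy : ∀ i ∉ supp M, i ≠ q → x i = y i) (hzw : ∀ i ∉ supp M', i ≠ q → z i = w i)
    (hu : ∀ i ∈ supp M, i ≠ q → u i = x i) (hu' : ∀ i ∈ supp M', i ≠ q → u i = z i)
    (hv : ∀ i ∈ supp M, i ≠ q → v i = y i) (hv' : ∀ i ∈ supp M', i ≠ q → v i = w i)
    (huv : ∀ i ∉ supp M, i ∉ supp M' → i ≠ q → u i = v i) (s t : Fin 2) :
    (M * M') (Function.update u q s) (Function.update v q t) =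
      (siteBlock M q x y * siteBlock M' q z w) s t := by
  classical
  have hdis : ∀ i, i ≠ q → i ∈ supp M → i ∉ supp M' := fun i hi h h' => hi (hint ⟨h, h'⟩)
  set m₀ : Fin n → Fin 2 := fun i => if i ∈ supp M then y i else u i with hm₀
  rw [Matrix.mul_apply, sum_eq_sum_update_s12 q m₀]
  · rw [Matrix.mul_apply]
    refine Finset.sum_congr rfl fun r _ => ?_
    simp only [siteBlock, Matrix.of_apply]
    congr 1
    · apply apply_congr_of_supp_subset (A := supp M ∪ {q}) Set.subset_union_left
      all_goals intro i hi
      all_goals by_cases hiq : i = q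
      all_goals first
        | (subst hiq; simp at hi; done)
        | (subst hiq; simp)
        | skip
      all_goals simp [hiq] at hi
      all_goals simp_all
    · apply apply_congr_of_supp_subset (A := supp M' ∪ {q}) Set.subset_union_left
      all_goals intro i hi
      all_goals by_cases hiq : i = q
      all_goals first
        | (subst hiq; simp at hi; done)
        | (subst hiq; simp)
        | skip
      all_goals simp [hiq] at hi
      all_goals by_cases hiM : i ∈ supp M
      all_goals have hd := hdis i hiq
      all_goals simp_all
  · intro m i hiq hne
    by_cases hi : i ∈ supp M
    · rw [apply_eq_zero_of_ne (M := M') (hdis i hiq hi), mul_zero]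
      simpa [hiq, hm₀, hi, hv i hi hiq] using hne
    · rw [apply_eq_zero_of_ne (M := M) hi, zero_mul]
      simpa [hiq, hm₀, hi, eq_comm] using hne

/-- Blocks at `q` of commuting operators whose supports meet only in `q` commute. -/
lemma siteBlock_commute {n : ℕ} {M M' : Matrix (Fin n → Fin 2) (Fin n → Fin 2) ℂ}
    {q : Fin n} (hint : supp M ∩ supp M' ⊆ {q}) (hcomm : Commute M M')
    (x y z w : Fin n → Fin 2) : Commute (siteBlock M q x y) (siteBlock M' q z w) := by
  classical
  by_cases hxy : ∀ i ∉ supp M, i ≠ q → x i = y i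
  swap
  · push Not at hxy
    obtain ⟨i, hi, hiq, hne⟩ := hxy
    rw [siteBlock_eq_zero hi hiq hne]
    exact Commute.zero_left _
  by_cases hzw : ∀ i ∉ supp M', i ≠ q → z i = w i
  swap
  · push Not at hzw
    obtain ⟨i, hi, hiq, hne⟩ := hzw
    rw [siteBlock_eq_zero hi hiq hne]
    exact Commute.zero_right _
  have hdis : ∀ i ∈ supp M', i ≠ q → i ∉ supp M := fun i h' hi h => hi (hint ⟨h, h'⟩)
  set u : Fin n → Fin 2 := fun i => if i ∈ supp M then x i else z i with hu
  set v : Fin n → Fin 2 := fun i => if i ∈ supp M then y i else w i with hv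
  have hux : ∀ i ∈ supp M, i ≠ q → u i = x i := fun i h _ => by simp [hu, h]
  have huz : ∀ i ∈ supp M', i ≠ q → u i = z i := fun i h hi => by simp [hu, hdis i h hi]
  have hvy : ∀ i ∈ supp M, i ≠ q → v i = y i := fun i h _ => by simp [hv, h]
  have hvw : ∀ i ∈ supp M', i ≠ q → v i = w i := fun i h hi => by simp [hv, hdis i h hi]
  have huv : ∀ i ∉ supp M, i ∉ supp M' → i ≠ q → u i = v i := fun i h h' hi => by
    simp [hu, hv, h, hzw i h' hi]
  ext s t
  rw [← mul_apply_glue hint hxy hzw hux huz hvy hvw huv, hcomm.eq,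
    mul_apply_glue (Set.inter_comm _ _ ▸ hint) hzw hxy huz hux hvw hvy
      fun i h' h => huv i h h']

lemma BlocksCommute.of_inter_subset {n : ℕ}
    {M M' : Matrix (Fin n → Fin 2) (Fin n → Fin 2) ℂ} {q : Fin n}
    {L : Matrix (Fin 2) (Fin 2) ℂ} (hM' : BlocksCommute M' q L) (hq : q ∈ supp M')
    (hint : supp M ∩ supp M' ⊆ {q}) (hcomm : Commute M M') : BlocksCommute M q L := by
  obtain ⟨z, w, hzw⟩ := exists_not_isScalarTwo_siteBlock hq
  exact fun x y => commute_trans_of_not_isScalarTwo hzw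
    (siteBlock_commute hint hcomm x y z w) (hM' z w)

/-- An operator acting nontrivially on `q` provides a non-scalar Hermitian matrix on `q`
commuting with the blocks of every commuting operator that meets it only in `q`. -/
lemma exists_isHermitian_blocksCommute {n : ℕ}
    {M : Matrix (Fin n → Fin 2) (Fin n → Fin 2) ℂ} {q : Fin n} (hM : M.IsHermitian)
    (hq : q ∈ supp M) :
    ∃ L : Matrix (Fin 2) (Fin 2) ℂ, L.IsHermitian ∧ ¬ IsScalarTwo L ∧
      ∀ M', supp M' ∩ supp M ⊆ {q} → Commute M' M → BlocksCommute M' q L := by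
  obtain ⟨x, y, hK⟩ := exists_not_isScalarTwo_siteBlock hq
  set K := siteBlock M q x y
  have hadj : siteBlock M q y x = Kᴴ := by
    ext s t
    exact (hM.apply _ _).symm
  have hcK : ∀ M', supp M' ∩ supp M ⊆ {q} → Commute M' M → ∀ z w,
      Commute (siteBlock M' q z w) K ∧ Commute (siteBlock M' q z w) Kᴴ := fun M' h hc z w =>
    ⟨siteBlock_commute h hc z w x y, hadj ▸ siteBlock_commute h hc z w y x⟩
  by_cases hre : IsScalarTwo (K + Kᴴ)
  · refine ⟨Complex.I • (K - Kᴴ), ?_, ?_, fun M' h hc z w =>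
      ((hcK M' h hc z w).1.sub_right (hcK M' h hc z w).2).smul_right _⟩
    · simp only [Matrix.IsHermitian, Matrix.conjTranspose_smul, Matrix.conjTranspose_sub,
        Matrix.conjTranspose_conjTranspose, Complex.star_def, Complex.conj_I, neg_smul,
        ← smul_neg, neg_sub]
    · intro him
      refine hK ?_
      simp only [IsScalarTwo, Matrix.add_apply, Matrix.sub_apply, Matrix.smul_apply,
        smul_eq_mul, ← mul_sub, mul_eq_zero, Complex.I_ne_zero, false_or] at hre him ⊢
      obtain ⟨r1, r2, r3⟩ := hre
      obtain ⟨i1, i2, i3⟩ := him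
      exact ⟨by linear_combination (r1 + i1) / 2, by linear_combination (r2 + i2) / 2,
        by linear_combination (r3 + i3) / 2⟩
  · refine ⟨K + Kᴴ, ?_, hre, fun M' h hc z w =>
      (hcK M' h hc z w).1.add_right (hcK M' h hc z w).2⟩
    simp only [Matrix.IsHermitian, Matrix.conjTranspose_add,
      Matrix.conjTranspose_conjTranspose, add_comm]

/-- An operator commutes with `projAt q v` if its blocks commute with `|v⟩⟨v|`. -/
lemma BlocksCommute.commute_projAt {n : ℕ}
    {M : Matrix (Fin n → Fin 2) (Fin n → Fin 2) ℂ} {q : Fin n} {v : Fin 2 → ℂ}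
    (h : BlocksCommute M q (Matrix.vecMulVec v (star v))) : Commute M (projAt q v) := by
  have hl : ∀ x y, (M * projAt q v) x y =
      (siteBlock M q x y * Matrix.vecMulVec v (star v)) (x q) (y q) := by
    intro x y
    rw [Matrix.mul_apply, Matrix.mul_apply, sum_eq_sum_update_s12 q y]
    · simp [siteBlock, projAt, Matrix.vecMulVec_apply]
    · intro m i hi hne
      have : Function.update m q (y q) ≠ y := fun he => hne (by
        rw [← he, Function.update_of_ne hi])
      simp [projAt, this]
  have hr : ∀ x y, (projAt q v * M) x y =
      (Matrix.vecMulVec v (star v) * siteBlock M q x y) (x q) (y q) := by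
    intro x y
    rw [Matrix.mul_apply, Matrix.mul_apply, sum_eq_sum_update_s12 q x]
    · simp [siteBlock, projAt, Matrix.vecMulVec_apply]
    · intro m i hi hne
      have : Function.update x q (m q) ≠ m := fun he => hne (by
        rw [← he, Function.update_of_ne hi])
      simp [projAt, this]
  ext x y
  rw [hl, hr, (h x y).eq]

/-- A non-scalar Hermitian `2 × 2` matrix has an orthonormal basis whose first vector spans
a line such that the projection onto it commutes with everything commuting with the matrix. -/
lemma exists_orthonormal_commute {L : Matrix (Fin 2) (Fin 2) ℂ} (hL : L.IsHermitian)
    (hns : ¬ IsScalarTwo L) :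
    ∃ v₀ v₁ : Fin 2 → ℂ, star v₀ ⬝ᵥ v₀ = 1 ∧ star v₁ ⬝ᵥ v₁ = 1 ∧ star v₀ ⬝ᵥ v₁ = 0 ∧
      ∀ A, Commute A L → Commute A (Matrix.vecMulVec v₀ (star v₀)) := by
  have horth : ∀ i j, star (hL.eigenvectorBasis i : Fin 2 → ℂ) ⬝ᵥ
      (hL.eigenvectorBasis j : Fin 2 → ℂ) = if i = j then 1 else 0 := by
    intro i j
    rw [← orthonormal_iff_ite.mp hL.eigenvectorBasis.orthonormal i j,
      EuclideanSpace.inner_eq_star_dotProduct, dotProduct_comm]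
  refine ⟨hL.eigenvectorBasis 0, hL.eigenvectorBasis 1, by simp [horth], by simp [horth],
    by simp [horth], fun A hA => commute_trans_of_not_isScalarTwo hns hA ?_⟩
  have he := hL.mulVec_eigenvectorBasis 0
  have hs : star (hL.eigenvectorBasis 0 : Fin 2 → ℂ) ᵥ* L =
      hL.eigenvalues 0 • star (hL.eigenvectorBasis 0 : Fin 2 → ℂ) := by
    have h := Matrix.star_mulVec L (hL.eigenvectorBasis 0 : Fin 2 → ℂ)
    rw [hL.eq, he] at h
    rw [← h]
    ext i
    simp
  rw [commute_iff_eq, Matrix.mul_vecMulVec, Matrix.vecMulVec_mul, he, hs]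
  simp

lemma separableAt_of_blocksCommute {n : ℕ}
    {S : Finset (Matrix (Fin n → Fin 2) (Fin n → Fin 2) ℂ)} {q : Fin n}
    {L : Matrix (Fin 2) (Fin 2) ℂ} (hL : L.IsHermitian) (hns : ¬ IsScalarTwo L)
    (h : ∀ H ∈ S, BlocksCommute H q L) : SeparableAt S q := by
  obtain ⟨v₀, v₁, h₀, h₁, h₀₁, hc⟩ := exists_orthonormal_commute hL hns
  exact ⟨v₀, v₁, h₀, h₁, h₀₁, fun H hH =>
    BlocksCommute.commute_projAt fun x y => hc _ (h H hH x y)⟩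

/-- A set of size at most `3` containing `q` and meeting every edge of the path
`a₁ - a₂ - a₃ - a₄ - a₅` away from `q` is `{q, a₂, a₄}`. -/
lemma eq_of_path_cover {α : Type*} [DecidableEq α] {A : Set α} (hfin : A.Finite)
    (hcard : A.ncard ≤ 3) {q a₁ a₂ a₃ a₄ a₅ : α}
    (hd : ({q, a₁, a₂, a₃, a₄, a₅} : Finset α).card = 6) (hq : q ∈ A)
    (h₁ : a₁ ∈ A ∨ a₂ ∈ A) (h₂ : a₂ ∈ A ∨ a₃ ∈ A) (h₃ : a₃ ∈ A ∨ a₄ ∈ A)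
    (h₄ : a₄ ∈ A ∨ a₅ ∈ A) : A = {q, a₂, a₄} := by
  have hnd : [q, a₁, a₂, a₃, a₄, a₅].Nodup := by
    rw [← Multiset.coe_nodup, ← Multiset.toFinset_card_eq_card_iff_nodup]
    simpa using hd
  simp only [List.nodup_cons, List.mem_cons, List.not_mem_nil, or_false, not_or] at hnd
  have hfour : ∀ b c d, b ∈ A → c ∈ A → d ∈ A → ({q, b, c, d} : Finset α).card ≤ 3 := by
    intro b c d hb hc hd
    rw [← Set.ncard_coe_finset]
    refine (Set.ncard_le_ncard ?_ hfin).trans hcard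
    intro e he
    simp at he
    rcases he with rfl | rfl | rfl | rfl <;> assumption
  have hne : ∀ b c d, q ≠ b → q ≠ c → q ≠ d → b ≠ c → b ≠ d → c ≠ d → b ∈ A → c ∈ A →
      d ∉ A := by
    intro b c d h1 h2 h3 h4 h5 h6 hb hc hd
    have := hfour b c d hb hc hd
    rw [Finset.card_insert_of_notMem (by simp [h1, h2, h3]),
      Finset.card_insert_of_notMem (by simp [h4, h5]), Finset.card_pair h6] at this
    omega
  have ha₂ : a₂ ∈ A := by
    by_contra h
    grind
  have ha₄ : a₄ ∈ A := by
    by_contra h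
    grind
  symm
  apply Set.eq_of_subset_of_ncard_le _ _ hfin
  · rintro e (rfl | rfl | rfl) <;> assumption
  · rw [Set.ncard_eq_three.mpr ⟨q, a₂, a₄, by grind, by grind, by grind, rfl⟩]
    exact hcard

/-- Claim 4.15, the Bridge Claim.  Let `S` be an instance of `CLH(3,2)`
and `q` a qubit that is not separable for `S`.  If `H₁, H₂, H₃, H₄` is an open operator path
on `q` of length 4 with supports `{q,a₁,a₂}`, `{q,a₂,a₃}`, `{q,a₃,a₄}`, `{q,a₄,a₅}` for
pairwise distinct particles `q, a₁, …, a₅`, then there is an operator `H ∈ S` with support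
`{q, a₂, a₄}`. -/
theorem bridge_claim
    {n : ℕ} (S : Finset (Matrix (Fin n → Fin 2) (Fin n → Fin 2) ℂ))
    (hclh : IsCLH32 S)
    (q a₁ a₂ a₃ a₄ a₅ : Fin n)
    (hdistinct : ({q, a₁, a₂, a₃, a₄, a₅} : Finset (Fin n)).card = 6)
    (hqnosep : ¬ SeparableAt S q)
    (P : Fin 4 → Matrix (Fin n → Fin 2) (Fin n → Fin 2) ℂ)
    (hpath : IsOpPathOn S q P)
    (hs₁ : supp (P 0) = {q, a₁, a₂}) (hs₂ : supp (P 1) = {q, a₂, a₃})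
    (hs₃ : supp (P 2) = {q, a₃, a₄}) (hs₄ : supp (P 3) = {q, a₄, a₅}) :
    ∃ H ∈ S, supp H = {q, a₂, a₄} := by
  classical
  obtain ⟨hproj, hcomm, hcard⟩ := hclh
  obtain ⟨-, hmem, hqP, -, hfar⟩ := hpath
  have hint : ∀ i k : Fin 4, 2 ≤ Nat.dist i.1 k.1 → supp (P i) ∩ supp (P k) ⊆ {q} :=
    fun i k h => (hfar i k h).subset
  have hcP : ∀ i k, Commute (P i) (P k) := fun i k => hcomm _ (hmem i) _ (hmem k)
  obtain ⟨L, hL, hns, hLc⟩ := exists_isHermitian_blocksCommute (hproj _ (hmem 0)).1 (hqP 0)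
  have hL2 : BlocksCommute (P 2) q L := hLc _ (hint 2 0 (by decide)) (hcP 2 0)
  have hL3 : BlocksCommute (P 3) q L := hLc _ (hint 3 0 (by decide)) (hcP 3 0)
  have hL0 : BlocksCommute (P 0) q L :=
    hL2.of_inter_subset (hqP 2) (hint 0 2 (by decide)) (hcP 0 2)
  have hL1 : BlocksCommute (P 1) q L :=
    hL3.of_inter_subset (hqP 3) (hint 1 3 (by decide)) (hcP 1 3)
  obtain ⟨H, hHS, hH⟩ : ∃ H ∈ S, ¬ BlocksCommute H q L := by
    by_contra! h
    exact hqnosep (separableAt_of_blocksCommute hL hns h)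
  have hmeet : ∀ i b c, supp (P i) = {q, b, c} → BlocksCommute (P i) q L →
      b ∈ supp H ∨ c ∈ supp H := by
    intro i b c hs hLi
    by_contra! hbc
    refine hH (hLi.of_inter_subset (hqP i) ?_ (hcomm _ hHS _ (hmem i)))
    rw [hs]
    rintro e ⟨he, rfl | rfl | rfl⟩
    · rfl
    · exact absurd he hbc.1
    · exact absurd he hbc.2
  exact ⟨H, hHS, eq_of_path_cover (Set.toFinite _) (hcard H hHS) hdistinct
    (mem_supp_of_not_blocksCommute hH) (hmeet 0 _ _ hs₁ hL0) (hmeet 1 _ _ hs₂ hL1)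
    (hmeet 2 _ _ hs₃ hL2) (hmeet 3 _ _ hs₄ hL3)⟩
end

section
/- Let H_q, E_L, E_R be finite-dimensional complex Hilbert spaces with 2 ≤ dim H_q ≤ 3, and consider the total space H_q ⊗ E_L ⊗ E_R. Let {L_i} be a nonempty finite family of operators each of the form L̃_i ⊗ I_{E_R} for a self-adjoint operator L̃_i on H_q ⊗ E_L, and let {R_j} be a nonempty finite family of operators each corresponding, under the canonical permutation of tensor factors, to R̃_j ⊗ I_{E_L} for a self-adjoint operator R̃_j on H_q ⊗ E_R. Assume that all the operators L_i and R_j pairwise commute and that each acts nontrivially on H_q. Then there exists a subspace S of H_q with 0 ≠ S ≠ H_q such that every L_i and every R_j commutes with (the orthogonal projection of H_q onto S) ⊗ I_{E_L⊗E_R}; equivalently, all these operators preserve the nontrivial direct-sum decomposition H_q = S ⊕ S^⊥. (Claim 5.10: a left-right partition of the operators on a qudit of dimension at most 3 forces agreement on a nontrivial decomposition.) -/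
open Matrix Kronecker

/-- The operator `M ⊗ I_{E_R}` on `H_q ⊗ E_L ⊗ E_R`, for `M` an operator on `H_q ⊗ E_L`. -/
def liftL {dq eL eR : ℕ} (M : Matrix (Fin dq × Fin eL) (Fin dq × Fin eL) ℂ) :
    Matrix (Fin dq × Fin eL × Fin eR) (Fin dq × Fin eL × Fin eR) ℂ :=
  Matrix.of fun p q =>
    M (p.1, p.2.1) (q.1, q.2.1) * (if p.2.2 = q.2.2 then 1 else 0)

/-- The operator on `H_q ⊗ E_L ⊗ E_R` corresponding, under the canonical permutation of
tensor factors, to `M ⊗ I_{E_L}` for `M` an operator on `H_q ⊗ E_R`. -/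
def liftR {dq eL eR : ℕ} (M : Matrix (Fin dq × Fin eR) (Fin dq × Fin eR) ℂ) :
    Matrix (Fin dq × Fin eL × Fin eR) (Fin dq × Fin eL × Fin eR) ℂ :=
  Matrix.of fun p q =>
    M (p.1, p.2.2) (q.1, q.2.2) * (if p.2.1 = q.2.1 then 1 else 0)

/-- An operator on `H_q ⊗ E` acts trivially on the first tensor factor `H_q` if it can be
written as `I_{H_q} ⊗ B` for some operator `B` on `E`. -/
def ActsTrivFst {dq : ℕ} {β : Type} (M : Matrix (Fin dq × β) (Fin dq × β) ℂ) : Prop :=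
  ∃ B : Matrix β β ℂ, ∀ p q, M p q = (if p.1 = q.1 then (1 : ℂ) else 0) * B p.2 q.2

/-- A non-scalar matrix yields a non-scalar Hermitian matrix in the span of it and its adjoint. -/
lemma exists_isHermitian_nonscalar {n : Type*} [Fintype n] [DecidableEq n] {X : Matrix n n ℂ}
    (hX : ∀ c : ℂ, X ≠ c • 1) :
    ∃ A : Matrix n n ℂ, A.IsHermitian ∧ (∀ c : ℂ, A ≠ c • 1) ∧
      ∀ Y, Commute Y X → Commute Y Xᴴ → Commute Y A := by
  by_cases h : ∀ c : ℂ, X + Xᴴ ≠ c • 1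
  · exact ⟨X + Xᴴ, isHermitian_add_transpose_self X, h, fun Y h₁ h₂ => h₁.add_right h₂⟩
  · push Not at h
    obtain ⟨c, hc⟩ := h
    refine ⟨Complex.I • (X - Xᴴ), ?_, fun d hd => hX ((c - Complex.I * d) / 2) ?_,
      fun Y h₁ h₂ => (h₁.sub_right h₂).smul_right _⟩
    · simp [IsHermitian, conjTranspose_smul, ← smul_neg]
    · have hd' : X - Xᴴ = (-(Complex.I * d)) • 1 := by
        rw [neg_smul, mul_smul, ← hd, smul_smul, Complex.I_mul_I, neg_one_smul, neg_neg]
      calc X = (1 / 2 : ℂ) • ((X + Xᴴ) + (X - Xᴴ)) := by module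
        _ = _ := by rw [hc, hd']; module

/-- A non-constant function on at most three points takes some value exactly once. -/
lemma exists_forall_ne_of_card_le_three {α : Type*} {n : ℕ} (hn : n ≤ 3) (d : Fin n → α)
    (hd : ¬ ∃ c, ∀ i, d i = c) (hn0 : 0 < n) : ∃ k, ∀ j, j ≠ k → d j ≠ d k := by
  by_contra! h
  apply hd
  interval_cases n
  · exact ⟨d 0, fun i => by fin_cases i; rfl⟩
  · obtain ⟨j, hj, hj'⟩ := h 0
    refine ⟨d 0, fun i => ?_⟩
    fin_cases j <;> fin_cases i <;> simp_all
  · obtain ⟨j, hj, hj'⟩ := h 0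
    obtain ⟨k, hk, hk'⟩ := h 1
    obtain ⟨l, hl, hl'⟩ := h 2
    refine ⟨d 0, fun i => ?_⟩
    fin_cases j <;> fin_cases k <;> fin_cases l <;> fin_cases i <;> simp_all

/-- In dimension at most three, a non-scalar Hermitian matrix has a simple eigenvalue, hence a
unit vector that is an eigenvector of everything in its commutant. -/
lemma exists_eigenvector_of_commutant {n : ℕ} (hn0 : 0 < n) (hn : n ≤ 3)
    {A : Matrix (Fin n) (Fin n) ℂ} (hA : A.IsHermitian) (hs : ∀ c : ℂ, A ≠ c • 1) :
    ∃ u : Fin n → ℂ, star u ⬝ᵥ u = 1 ∧ ∀ X, Commute X A → ∃ c : ℂ, X *ᵥ u = c • u := by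
  set U : Matrix (Fin n) (Fin n) ℂ := hA.eigenvectorUnitary.1
  set D : Matrix (Fin n) (Fin n) ℂ := diagonal fun i => (hA.eigenvalues i : ℂ) with hD
  have hUU : Uᴴ * U = 1 := Unitary.coe_star_mul_self hA.eigenvectorUnitary
  have hUU' : U * Uᴴ = 1 := mul_eq_one_comm.mp hUU
  have hAD : A = U * D * Uᴴ := hA.spectral_theorem
  obtain ⟨k, hk⟩ := exists_forall_ne_of_card_le_three hn hA.eigenvalues (by
    rintro ⟨c, hc⟩
    refine hs c ?_
    have : D = (c : ℂ) • 1 := by simp [hD, hc, smul_one_eq_diagonal]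
    rw [hAD, this, mul_smul_comm, mul_one, smul_mul_assoc, hUU']) hn0
  refine ⟨fun i => U i k, ?_, fun X hX => ?_⟩
  · have := congrFun (congrFun hUU k) k
    simpa [mul_apply, dotProduct] using this
  · set W := Uᴴ * X * U with hW
    have hXU : X * U = U * W := by
      rw [hW, ← mul_assoc, ← mul_assoc, hUU', one_mul]
    have hDA : D = Uᴴ * A * U := by
      rw [hAD, ← mul_assoc, ← mul_assoc, hUU, one_mul, mul_assoc, hUU, mul_one]
    have hWD : W * D = D * W := by
      calc W * D = Uᴴ * X * (U * Uᴴ) * A * U := by rw [hDA, hW]; simp only [mul_assoc]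
        _ = Uᴴ * (X * A) * U := by rw [hUU', mul_one]; simp only [mul_assoc]
        _ = Uᴴ * A * (U * Uᴴ) * X * U := by rw [hX.eq, hUU', mul_one]; simp only [mul_assoc]
        _ = D * W := by rw [hDA, hW]; simp only [mul_assoc]
    have hW0 : ∀ j, j ≠ k → W j k = 0 := by
      intro j hj
      have h := congrFun (congrFun hWD j) k
      rw [hD, mul_diagonal, diagonal_mul] at h
      have hne : (hA.eigenvalues k : ℂ) - hA.eigenvalues j ≠ 0 :=
        sub_ne_zero.mpr fun h => hk j hj (by exact_mod_cast h.symm)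
      exact (mul_eq_zero.mp (by linear_combination h :
        W j k * ((hA.eigenvalues k : ℂ) - hA.eigenvalues j) = 0)).resolve_right hne
    refine ⟨W k k, funext fun i => ?_⟩
    have h := congrFun (congrFun hXU i) k
    rw [mul_apply, mul_apply, Finset.sum_eq_single (f := fun j => U i j * W j k) k
      (fun j _ hj => by rw [hW0 j hj, mul_zero]) (by simp)] at h
    simpa [mulVec, dotProduct, mul_comm] using h

/-- If a unit vector is an eigenvector of `X` and of `Xᴴ`, then `X` commutes with the projection
onto its span. -/
lemma commute_vecMulVec_of_eigenvector {n : Type*} [Fintype n] {X : Matrix n n ℂ} {u : n → ℂ}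
    (hu : star u ⬝ᵥ u = 1) {c d : ℂ} (hc : X *ᵥ u = c • u) (hd : Xᴴ *ᵥ u = d • u) :
    Commute X (vecMulVec u (star u)) := by
  have hd' : star u ᵥ* X = star d • star u := by
    rw [← star_smul, ← hd, star_mulVec, conjTranspose_conjTranspose]
  have hcd : c = star d := by
    have h : star u ⬝ᵥ (X *ᵥ u) = (star u ᵥ* X) ⬝ᵥ u := dotProduct_mulVec _ _ _
    simpa [hc, hd', hu] using h
  rw [Commute, SemiconjBy, mul_vecMulVec, vecMulVec_mul, hc, hd', hcd, smul_vecMulVec,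
    vecMulVec_smul]

/-- Three orthonormal vectors in dimension at most three resolve the identity. -/
lemma sum_vecMulVec_eq_one {n : ℕ} (hn : n ≤ 3) {e : Fin 3 → Fin n → ℂ}
    (he : ∀ i j, star (e i) ⬝ᵥ e j = if i = j then 1 else 0) :
    ∑ i, vecMulVec (e i) (star (e i)) = 1 := by
  set M : Matrix (Fin n) (Fin 3) ℂ := (of e)ᵀ with hM
  have hMM : Mᴴ * M = 1 := by
    ext i j
    rw [one_apply, ← he i j]
    simp [hM, mul_apply, dotProduct]
  have h3 : 3 ≤ n := by
    have h₁ : (Mᴴ * M).rank = 3 := by rw [hMM, rank_one, Fintype.card_fin]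
    have h₂ := (rank_mul_le_right Mᴴ M).trans (rank_le_height M)
    omega
  obtain rfl : n = 3 := le_antisymm hn h3
  rw [← mul_eq_one_comm.mp hMM]
  ext i j
  simp [hM, mul_apply, Matrix.sum_apply, vecMulVec_apply]

lemma isHermitian_vecMulVec_star {n : Type*} (u : n → ℂ) :
    (vecMulVec u (star u)).IsHermitian := by
  ext i j
  simp [vecMulVec_apply, mul_comm]

lemma vecMulVec_star_mul_self {n : Type*} [Fintype n] {u : n → ℂ} (hu : star u ⬝ᵥ u = 1) :
    vecMulVec u (star u) * vecMulVec u (star u) = vecMulVec u (star u) := by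
  rw [vecMulVec_mul_vecMulVec, hu, one_smul]

/-- Two mutually commuting, self-adjoint sets of matrices of size two or three, neither of which
consists of scalars, commute with a common rank-one projection. -/
lemma exists_common_rankOne_projection {n : ℕ} (hn0 : 0 < n) (hn : n ≤ 3)
    {S T : Set (Matrix (Fin n) (Fin n) ℂ)} (hS : ∀ X ∈ S, Xᴴ ∈ S) (hT : ∀ Y ∈ T, Yᴴ ∈ T)
    (hST : ∀ X ∈ S, ∀ Y ∈ T, Commute X Y) (hSn : ∃ X ∈ S, ∀ c : ℂ, X ≠ c • 1)
    (hTn : ∃ Y ∈ T, ∀ c : ℂ, Y ≠ c • 1) :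
    ∃ u : Fin n → ℂ, star u ⬝ᵥ u = 1 ∧ (∀ X ∈ S, Commute X (vecMulVec u (star u))) ∧
      ∀ Y ∈ T, Commute Y (vecMulVec u (star u)) := by
  obtain ⟨X₀, hX₀, hX₀n⟩ := hSn
  obtain ⟨Y₀, hY₀, hY₀n⟩ := hTn
  obtain ⟨A, hA, hAn, hAc⟩ := exists_isHermitian_nonscalar hX₀n
  obtain ⟨B, hB, hBn, hBc⟩ := exists_isHermitian_nonscalar hY₀n
  obtain ⟨u, hu, hAu⟩ := exists_eigenvector_of_commutant hn0 hn hA hAn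
  obtain ⟨v, hv, hBv⟩ := exists_eigenvector_of_commutant hn0 hn hB hBn
  have hTA : ∀ Y ∈ T, Commute Y A := fun Y hY =>
    hAc Y (hST _ hX₀ _ hY).symm (hST _ (hS _ hX₀) _ hY).symm
  have hSB : ∀ X ∈ S, Commute X B := fun X hX =>
    hBc X (hST _ hX _ hY₀) (hST _ hX _ (hT _ hY₀))
  have hAB : Commute A B :=
    hBc A (hTA _ hY₀).symm (hTA _ (hT _ hY₀)).symm
  have hTu : ∀ Y ∈ T, Commute Y (vecMulVec u (star u)) := fun Y hY =>
    commute_vecMulVec_of_eigenvector hu (hAu _ (hTA _ hY)).choose_spec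
      (hAu _ (hTA _ (hT _ hY))).choose_spec
  have hSv : ∀ X ∈ S, Commute X (vecMulVec v (star v)) := fun X hX =>
    commute_vecMulVec_of_eigenvector hv (hBv _ (hSB _ hX)).choose_spec
      (hBv _ (hSB _ (hS _ hX))).choose_spec
  obtain ⟨a, ha⟩ := hBv A hAB
  have hAv : Commute A (vecMulVec v (star v)) :=
    commute_vecMulVec_of_eigenvector hv ha (by rw [hA.eq]; exact ha)
  obtain ⟨c, hc⟩ := hAu _ hAv.symm
  rw [vecMulVec_mulVec] at hc
  by_cases hvu : star v ⬝ᵥ u = 0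
  swap
  · -- `u` and `v` are proportional
    refine ⟨v, hv, hSv, fun Y hY => ?_⟩
    have hvcu : v = ((star v ⬝ᵥ u)⁻¹ * c) • u := by
      rw [mul_smul, ← hc]
      ext i
      simp
      field_simp
    have key : ∀ Z, Commute Z A → ∃ d : ℂ, Z *ᵥ v = d • v := by
      intro Z hZ
      obtain ⟨d, hd⟩ := hAu Z hZ
      refine ⟨d, ?_⟩
      rw [hvcu, mulVec_smul, hd, smul_comm]
    exact commute_vecMulVec_of_eigenvector hv (key _ (hTA _ hY)).choose_spec
      (key _ (hTA _ (hT _ hY))).choose_spec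
  by_cases hSu : ∀ X ∈ S, ∃ d : ℂ, X *ᵥ u = d • u
  · exact ⟨u, hu, fun X hX => commute_vecMulVec_of_eigenvector hu (hSu X hX).choose_spec
      (hSu _ (hS X hX)).choose_spec, hTu⟩
  push Not at hSu
  obtain ⟨X, hX, hXu⟩ := hSu
  refine ⟨v, hv, hSv, ?_⟩
  set w : Fin n → ℂ := X *ᵥ u - (star u ⬝ᵥ X *ᵥ u) • u with hw
  have hw0 : w ≠ 0 := fun h => hXu _ (sub_eq_zero.mp h)
  have huw : star u ⬝ᵥ w = 0 := by simp [hw, dotProduct_sub, hu]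
  have hvw : star v ⬝ᵥ w = 0 := by
    obtain ⟨d, hd⟩ := hBv _ (hSB _ (hS _ hX))
    have hd' : star v ᵥ* X = star d • star v := by
      rw [← star_smul, ← hd, star_mulVec, conjTranspose_conjTranspose]
    rw [hw, dotProduct_sub, dotProduct_mulVec, hd']
    simp [hvu]
  have hTw : ∀ Y ∈ T, ∀ b : ℂ, Y *ᵥ u = b • u → Y *ᵥ w = b • w := by
    intro Y hY b hb
    have h : Y *ᵥ (X *ᵥ u) = b • (X *ᵥ u) := by
      rw [mulVec_mulVec, ← (hST _ hX _ hY).eq, ← mulVec_mulVec, hb, mulVec_smul]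
    rw [hw, mulVec_sub, mulVec_smul, h, hb, smul_sub, smul_comm]
  obtain ⟨r, hr⟩ : ∃ r : ℂ, star (r • w) ⬝ᵥ (r • w) = 1 := by
    have hnorm : star w ⬝ᵥ w = ((‖WithLp.toLp 2 w‖ ^ 2 : ℝ) : ℂ) := by
      simp [EuclideanSpace.norm_sq_eq, dotProduct, Complex.conj_mul']
    have hpos : ‖WithLp.toLp 2 w‖ ≠ 0 := by simpa using hw0
    refine ⟨((‖WithLp.toLp 2 w‖⁻¹ : ℝ) : ℂ), ?_⟩
    rw [star_smul, smul_dotProduct, dotProduct_smul, hnorm]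
    simp only [smul_eq_mul, Complex.star_def, Complex.conj_ofReal]
    norm_cast
    field_simp
  have hsum := sum_vecMulVec_eq_one hn (e := ![u, v, r • w]) (by
    have swap_zero : ∀ {x y : Fin n → ℂ}, star x ⬝ᵥ y = 0 → star y ⬝ᵥ x = 0 := fun {x y} h => by
      rw [star_dotProduct, h, star_zero]
    have huv : star u ⬝ᵥ v = 0 := swap_zero hvu
    have hwu : star w ⬝ᵥ u = 0 := swap_zero huw
    have hwv : star w ⬝ᵥ v = 0 := swap_zero hvw
    intro i j
    fin_cases i <;> fin_cases j <;>
      first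
      | exact hr
      | simp [hu, hv, huv, hvu, huw, hvw, hwu, hwv])
  rw [Fin.sum_univ_three] at hsum
  simp only [cons_val_zero, cons_val_one, cons_val_two, head_cons, tail_cons] at hsum
  set Q := vecMulVec v (star v) with hQ
  have hQQ : Q * Q = Q := vecMulVec_star_mul_self hv
  have hQh : Qᴴ = Q := isHermitian_vecMulVec_star v
  have key : ∀ Z ∈ T, Q * Z = Q * Z * Q := by
    intro Z hZ
    obtain ⟨b, hb⟩ := hAu Z (hTA Z hZ)
    have hbw : Z *ᵥ (r • w) = b • (r • w) := by
      rw [mulVec_smul, hTw Z hZ b hb, smul_comm]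
    have hcompl : vecMulVec u (star u) + vecMulVec (r • w) (star (r • w)) = 1 - Q := by
      rw [← hsum]; abel
    have hZ : Z * (1 - Q) = b • (1 - Q) := by
      rw [← hcompl, mul_add, mul_vecMulVec, mul_vecMulVec, hb, hbw, smul_vecMulVec,
        smul_vecMulVec, smul_add]
    have h := congrArg (Q * ·) hZ
    simp only [mul_smul_comm, mul_sub, mul_one, hQQ, sub_self, smul_zero] at h
    rw [mul_assoc]
    exact sub_eq_zero.mp h
  intro Y hY
  have h := congrArg conjTranspose (key _ (hT Y hY))
  simp only [conjTranspose_mul, conjTranspose_conjTranspose, hQh] at h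
  rw [Commute, SemiconjBy, h, key Y hY, mul_assoc]

lemma commute_liftL_liftR_iff {dq eL eR : ℕ} (L : Matrix (Fin dq × Fin eL) (Fin dq × Fin eL) ℂ)
    (R : Matrix (Fin dq × Fin eR) (Fin dq × Fin eR) ℂ) :
    Commute (liftL (eR := eR) L) (liftR (eL := eL) R) ↔
      ∀ a b r s, Commute (of fun i j => L (i, a) (j, b)) (of fun i j => R (i, r) (j, s)) := by
  have h₁ : ∀ i a r j b s, (liftL (eR := eR) L * liftR (eL := eL) R) (i, a, r) (j, b, s) =
      ((of fun i j => L (i, a) (j, b)) * (of fun i j => R (i, r) (j, s)) :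
        Matrix (Fin dq) (Fin dq) ℂ) i j := by
    intro i a r j b s
    simp [mul_apply, liftL, liftR, Fintype.sum_prod_type]
  have h₂ : ∀ i a r j b s, (liftR (eL := eL) R * liftL (eR := eR) L) (i, a, r) (j, b, s) =
      ((of fun i j => R (i, r) (j, s)) * (of fun i j => L (i, a) (j, b)) :
        Matrix (Fin dq) (Fin dq) ℂ) i j := by
    intro i a r j b s
    simp [mul_apply, liftL, liftR, Fintype.sum_prod_type]
  constructor
  · intro h a b r s
    ext i j
    rw [← h₁, ← h₂, h.eq]
  · intro h
    ext ⟨i, a, r⟩ ⟨j, b, s⟩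
    rw [h₁, h₂, (h a b r s).eq]

lemma commute_liftL_kronecker_one {dq eL eR : ℕ}
    {L : Matrix (Fin dq × Fin eL) (Fin dq × Fin eL) ℂ} {P : Matrix (Fin dq) (Fin dq) ℂ}
    (h : ∀ a b, Commute (of fun i j => L (i, a) (j, b)) P) :
    Commute (liftL (eR := eR) L)
      (P ⊗ₖ (1 : Matrix (Fin eL × Fin eR) (Fin eL × Fin eR) ℂ)) := by
  ext ⟨i, a, r⟩ ⟨j, b, s⟩
  have h' := congrFun (congrFun (h a b).eq i) j
  by_cases hrs : r = s <;>
    simp_all [mul_apply, liftL, Fintype.sum_prod_type, one_apply, Prod.ext_iff, ite_and]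

lemma commute_liftR_kronecker_one {dq eL eR : ℕ}
    {R : Matrix (Fin dq × Fin eR) (Fin dq × Fin eR) ℂ} {P : Matrix (Fin dq) (Fin dq) ℂ}
    (h : ∀ r s, Commute (of fun i j => R (i, r) (j, s)) P) :
    Commute (liftR (eL := eL) R)
      (P ⊗ₖ (1 : Matrix (Fin eL × Fin eR) (Fin eL × Fin eR) ℂ)) := by
  ext ⟨i, a, r⟩ ⟨j, b, s⟩
  have h' := congrFun (congrFun (h r s).eq i) j
  by_cases hab : a = b <;>
    simp_all [mul_apply, liftR, Fintype.sum_prod_type, one_apply, Prod.ext_iff, ite_and]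

lemma exists_nonscalar_block_of_liftL {dq eL eR : ℕ}
    {L : Matrix (Fin dq × Fin eL) (Fin dq × Fin eL) ℂ}
    (h : ¬ ActsTrivFst (liftL (eR := eR) L)) :
    ∃ a b, ∀ c : ℂ, (of fun i j => L (i, a) (j, b) : Matrix (Fin dq) (Fin dq) ℂ) ≠ c • 1 := by
  by_contra! hc
  choose c hc using hc
  refine h ⟨of fun p q => c p.1 q.1 * if p.2 = q.2 then 1 else 0, ?_⟩
  rintro ⟨i, a, r⟩ ⟨j, b, s⟩
  have h' : L (i, a) (j, b) = c a b * if i = j then 1 else 0 := by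
    simpa [one_apply] using congrFun (congrFun (hc a b) i) j
  simp only [liftL, of_apply, h']
  ring

lemma exists_nonscalar_block_of_liftR {dq eL eR : ℕ}
    {R : Matrix (Fin dq × Fin eR) (Fin dq × Fin eR) ℂ}
    (h : ¬ ActsTrivFst (liftR (eL := eL) R)) :
    ∃ r s, ∀ c : ℂ, (of fun i j => R (i, r) (j, s) : Matrix (Fin dq) (Fin dq) ℂ) ≠ c • 1 := by
  by_contra! hc
  choose c hc using hc
  refine h ⟨of fun p q => c p.2 q.2 * if p.1 = q.1 then 1 else 0, ?_⟩
  rintro ⟨i, a, r⟩ ⟨j, b, s⟩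
  have h' : R (i, r) (j, s) = c r s * if i = j then 1 else 0 := by
    simpa [one_apply] using congrFun (congrFun (hc r s) i) j
  simp only [liftR, of_apply, h']
  ring

/-- The set of blocks of a family of Hermitian matrices is closed under adjoints. -/
lemma conjTranspose_block_mem {ι m n : Type*} {M : ι → Matrix (m × n) (m × n) ℂ}
    (hM : ∀ i, (M i).IsHermitian) {X : Matrix m m ℂ}
    (hX : X ∈ {X | ∃ i a b, X = of fun x y => M i (x, a) (y, b)}) :
    Xᴴ ∈ {X | ∃ i a b, X = of fun x y => M i (x, a) (y, b)} := by
  obtain ⟨i, a, b, rfl⟩ := hX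
  refine ⟨i, b, a, ?_⟩
  ext x y
  exact (hM i).apply (x, b) (y, a)

/-- Claim 5.10.  Let `2 ≤ dim H_q ≤ 3`, let `{L_i}` be a nonempty finite
family of self-adjoint operators supported on `H_q ⊗ E_L` and `{R_j}` a nonempty finite
family of self-adjoint operators supported on `H_q ⊗ E_R`, all pairwise commuting and each
acting nontrivially on `H_q`.  Then there is a subspace `S` of `H_q` with `0 ≠ S ≠ H_q`
(given by its orthogonal projection `P`, a nonzero, non-identity Hermitian idempotent) such
that every `L_i` and every `R_j` commutes with `P ⊗ I`; i.e. all the operators preserve the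
nontrivial decomposition `H_q = S ⊕ S^⊥`. -/
theorem left_right_partition_forces_common_decomposition
    {dq eL eR : ℕ} (hdq2 : 2 ≤ dq) (hdq3 : dq ≤ 3)
    {ι κ : Type} [Fintype ι] [Fintype κ] [Nonempty ι] [Nonempty κ]
    (Lop : ι → Matrix (Fin dq × Fin eL) (Fin dq × Fin eL) ℂ)
    (Rop : κ → Matrix (Fin dq × Fin eR) (Fin dq × Fin eR) ℂ)
    (hLsa : ∀ i, (Lop i).IsHermitian) (hRsa : ∀ j, (Rop j).IsHermitian)
    (hLL : ∀ i i', Commute (liftL (eR := eR) (Lop i)) (liftL (eR := eR) (Lop i')))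
    (hRR : ∀ j j', Commute (liftR (eL := eL) (Rop j)) (liftR (eL := eL) (Rop j')))
    (hLR : ∀ i j, Commute (liftL (eR := eR) (Lop i)) (liftR (eL := eL) (Rop j)))
    (hLnt : ∀ i, ¬ ActsTrivFst (liftL (eR := eR) (Lop i)))
    (hRnt : ∀ j, ¬ ActsTrivFst (liftR (eL := eL) (Rop j))) :
    ∃ P : Matrix (Fin dq) (Fin dq) ℂ,
      P.IsHermitian ∧ P * P = P ∧ P ≠ 0 ∧ P ≠ 1 ∧
      (∀ i, Commute (liftL (eR := eR) (Lop i))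
        (P ⊗ₖ (1 : Matrix (Fin eL × Fin eR) (Fin eL × Fin eR) ℂ))) ∧
      (∀ j, Commute (liftR (eL := eL) (Rop j))
        (P ⊗ₖ (1 : Matrix (Fin eL × Fin eR) (Fin eL × Fin eR) ℂ))) := by
  obtain ⟨i₀⟩ := ‹Nonempty ι›
  obtain ⟨j₀⟩ := ‹Nonempty κ›
  obtain ⟨a, b, hab⟩ := exists_nonscalar_block_of_liftL (hLnt i₀)
  obtain ⟨r, s, hrs⟩ := exists_nonscalar_block_of_liftR (hRnt j₀)
  obtain ⟨u, hu, hL, hR⟩ := exists_common_rankOne_projection (by omega) hdq3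
    (S := {X | ∃ i a b, X = of fun x y => Lop i (x, a) (y, b)})
    (T := {X | ∃ j r s, X = of fun x y => Rop j (x, r) (y, s)})
    (fun _ => conjTranspose_block_mem hLsa) (fun _ => conjTranspose_block_mem hRsa)
    (by
      rintro _ ⟨i, a, b, rfl⟩ _ ⟨j, r, s, rfl⟩
      exact (commute_liftL_liftR_iff _ _).mp (hLR i j) a b r s)
    ⟨_, ⟨i₀, a, b, rfl⟩, hab⟩ ⟨_, ⟨j₀, r, s, rfl⟩, hrs⟩
  have htr : (vecMulVec u (star u)).trace = 1 := by
    rw [trace_vecMulVec, dotProduct_comm, hu]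
  refine ⟨vecMulVec u (star u), isHermitian_vecMulVec_star u, vecMulVec_star_mul_self hu,
    fun h => ?_, fun h => ?_,
    fun i => commute_liftL_kronecker_one fun a b => hL _ ⟨i, a, b, rfl⟩,
    fun j => commute_liftR_kronecker_one fun r s => hR _ ⟨j, r, s, rfl⟩⟩
  · simp [h] at htr
  · rw [h, trace_one, Fintype.card_fin] at htr
    have : dq = 1 := by exact_mod_cast htr
    omega
end
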